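/- Let γ = 0 and d = 0, and let L > 0. The linearisation L_pin about the unique pinned fluxon for parameters (L, 0, 0) has a largest eigenvalue Λ_max ∈ (−1, 0), and μ := √(1 + Λ_max) ∈ (0,1) is the largest solution of the implicit equation −μ·[μ + ½√(2(1+cos φ_in))] + ½(1 − cos φ_in) = −√(1−μ²)·[μ + ½√(2(1+cos φ_in))]·tan(√(1−μ²)·(π − φ_in)/√(2(1−cos φ_in))), where φ_in = arccos(1−h) and h ∈ (0,2) is the unique solution of L = (π − arccos(1−h))/√(2h). -/

import Mathlib

open Real Filter Topology

/-- The piecewise-constant Josephson tunneling critical current: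
`D(x) = d` for `|x| < L` and `D(x) = 1` for `|x| > L`. -/
noncomputable def Dfun (L d : ℝ) (x : ℝ) : ℝ := if |x| < L then d else 1

/-- A pinned fluxon for parameters `(L, d, γ)`. -/
def IsPinnedFluxon (L d γ : ℝ) (φ : ℝ → ℝ) : Prop :=
  ContDiff ℝ 1 φ ∧
  (∀ x : ℝ, x ≠ -L → x ≠ L →
    ∃ φ'' : ℝ, HasDerivAt (deriv φ) φ'' x ∧
      φ'' - Dfun L d x * Real.sin (φ x) + γ = 0) ∧
  Tendsto φ atBot (𝓝 (Real.arcsin γ)) ∧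
  Tendsto φ atTop (𝓝 (Real.arcsin γ + 2 * π)) ∧
  Tendsto (deriv φ) atBot (𝓝 0) ∧
  Tendsto (deriv φ) atTop (𝓝 0)

/-- `ψ` is an eigenfunction of the linearisation about `φpin` with eigenvalue `Λ`. -/
def IsEigenfun (L d γ : ℝ) (φpin : ℝ → ℝ) (Λ : ℝ) (ψ : ℝ → ℝ) : Prop :=
  ψ ≠ 0 ∧ ContDiff ℝ 1 ψ ∧
  (∀ x : ℝ, x ≠ -L → x ≠ L →
    ∃ ψ'' : ℝ, HasDerivAt (deriv ψ) ψ'' x ∧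
      ψ'' - Dfun L d x * Real.cos (φpin x) * ψ x = Λ * ψ x) ∧
  Tendsto ψ atBot (𝓝 0) ∧ Tendsto ψ atTop (𝓝 0) ∧
  Tendsto (deriv ψ) atBot (𝓝 0) ∧ Tendsto (deriv ψ) atTop (𝓝 0)

/-- `Λ` is an eigenvalue of the linearisation `L_pin` about the pinned fluxon `φpin`. -/
def IsEigenvalue (L d γ : ℝ) (φpin : ℝ → ℝ) (Λ : ℝ) : Prop :=
  ∃ ψ : ℝ → ℝ, IsEigenfun L d γ φpin Λ ψ

/-- The implicit equation `(eq. for Λ_max)` in the variables `φ_in` and `μ`. -/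
noncomputable def EigEqn (φin μ : ℝ) : Prop :=
  -μ * (μ + (1 / 2) * Real.sqrt (2 * (1 + Real.cos φin)))
      + (1 / 2) * (1 - Real.cos φin) =
    -Real.sqrt (1 - μ ^ 2) * (μ + (1 / 2) * Real.sqrt (2 * (1 + Real.cos φin))) *
      Real.tan (Real.sqrt (1 - μ ^ 2) * (π - φin) / Real.sqrt (2 * (1 - Real.cos φin)))

/-! ### Monotonicity and linear first-order equations -/

theorem le_of_deriv_nonneg_of_tendsto_atBot {f f' : ℝ → ℝ} {b l : ℝ}
    (hf : ContinuousOn f (Set.Iic b)) (hd : ∀ x < b, HasDerivAt f (f' x) x)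
    (hn : ∀ x < b, 0 ≤ f' x) (hl : Tendsto f atBot (𝓝 l)) {x : ℝ} (hx : x ≤ b) : l ≤ f x := by
  have hm : MonotoneOn f (Set.Iic b) := by
    apply monotoneOn_of_hasDerivWithinAt_nonneg (convex_Iic b) hf (f' := f')
    · intro y hy
      rw [interior_Iic] at hy
      exact (hd y hy).hasDerivWithinAt
    · intro y hy
      rw [interior_Iic] at hy
      exact hn y hy
  refine le_of_tendsto hl ?_
  filter_upwards [eventually_le_atBot x] with y hy
  exact hm (hy.trans hx) hx hy

theorem eq_of_deriv_eq_zero_of_tendsto_atBot {f : ℝ → ℝ} {b l : ℝ}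
    (hf : ContinuousOn f (Set.Iic b)) (hd : ∀ x < b, HasDerivAt f 0 x)
    (hl : Tendsto f atBot (𝓝 l)) {x : ℝ} (hx : x ≤ b) : f x = l := by
  refine le_antisymm ?_
    (le_of_deriv_nonneg_of_tendsto_atBot (f' := fun _ => 0) hf hd (fun _ _ => le_rfl) hl hx)
  have := le_of_deriv_nonneg_of_tendsto_atBot (f' := fun _ => 0) hf.neg
    (fun y hy => by simpa using (hd y hy).neg) (fun _ _ => le_rfl) hl.neg hx
  simpa using this

theorem monotone_of_deriv_nonneg_off {f f' : ℝ → ℝ} {a b : ℝ} (hab : a ≤ b) (hf : Continuous f)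
    (hd : ∀ x, x ≠ a → x ≠ b → HasDerivAt f (f' x) x)
    (hn : ∀ x, x ≠ a → x ≠ b → 0 ≤ f' x) : Monotone f := by
  have key : ∀ s : Set ℝ, Convex ℝ s → (∀ x ∈ interior s, x ≠ a ∧ x ≠ b) → MonotoneOn f s := by
    intro s hs h
    exact monotoneOn_of_hasDerivWithinAt_nonneg hs hf.continuousOn (f' := f')
      (fun y hy => (hd y (h y hy).1 (h y hy).2).hasDerivWithinAt)
      (fun y hy => hn y (h y hy).1 (h y hy).2)
  have h1 : MonotoneOn f (Set.Iic a) := key _ (convex_Iic a) fun x hx => by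
    rw [interior_Iic] at hx
    have : x < a := hx
    exact ⟨this.ne, (this.trans_le hab).ne⟩
  have h2 : MonotoneOn f (Set.Icc a b) := key _ (convex_Icc a b) fun x hx => by
    rw [interior_Icc] at hx
    exact ⟨hx.1.ne', hx.2.ne⟩
  have h3 : MonotoneOn f (Set.Ici b) := key _ (convex_Ici b) fun x hx => by
    rw [interior_Ici] at hx
    have : b < x := hx
    exact ⟨(hab.trans_lt this).ne', this.ne'⟩
  have h4 : MonotoneOn f (Set.Iic b) := by
    rw [← Set.Iic_union_Icc_eq_Iic hab]
    exact h1.union_right h2 isGreatest_Iic (isLeast_Icc hab)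
  exact h4.Iic_union_Ici h3

theorem eq_zero_of_linear_backward {q c : ℝ → ℝ} {a b : ℝ} (hab : a ≤ b) (hq : Continuous q)
    (hd : ∀ x ∈ Set.Ioo a b, HasDerivAt q (c x * q x) x) (hc : ∀ x, |c x| ≤ 1) (h0 : q b = 0) :
    q a = 0 := by
  have hm : MonotoneOn (fun x => Real.exp (2 * x) * q x ^ 2) (Set.Icc a b) := by
    apply monotoneOn_of_hasDerivWithinAt_nonneg (convex_Icc a b) (by fun_prop)
      (f' := fun x => Real.exp (2 * x) * (2 * (1 + c x) * q x ^ 2))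
    · intro x hx
      rw [interior_Icc] at hx
      have h1 : HasDerivAt (fun x : ℝ => Real.exp (2 * x)) (Real.exp (2 * x) * (2 * 1)) x :=
        ((hasDerivAt_id x).const_mul 2).exp
      have h2 := h1.mul ((hd x hx).pow 2)
      refine (h2.congr_deriv ?_).hasDerivWithinAt
      simp only [Pi.pow_apply]
      push_cast
      ring
    · intro x _
      have := (abs_le.1 (hc x)).1
      have : 0 ≤ 1 + c x := by linarith
      positivity
  have h := hm (Set.left_mem_Icc.2 hab) (Set.right_mem_Icc.2 hab) hab
  simp only [h0] at h
  have h' : q a ^ 2 ≤ 0 := by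
    by_contra hcon
    push Not at hcon
    have := mul_pos (Real.exp_pos (2 * a)) hcon
    nlinarith
  exact pow_eq_zero_iff two_ne_zero |>.1 (le_antisymm h' (sq_nonneg _))

theorem eq_zero_of_linear_forward {q c : ℝ → ℝ} {a b : ℝ} (hab : a ≤ b) (hq : Continuous q)
    (hd : ∀ x ∈ Set.Ioo a b, HasDerivAt q (c x * q x) x) (hc : ∀ x, |c x| ≤ 1) (h0 : q a = 0) :
    q b = 0 := by
  have := eq_zero_of_linear_backward (q := fun x => q (-x)) (c := fun x => -c (-x))
    (neg_le_neg hab) (by fun_prop) (fun x hx => ?_) (fun x => by simpa using hc (-x))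
    (by simpa using h0)
  · simpa using this
  · have h1 := (hd (-x) ⟨by linarith [hx.2], by linarith [hx.1]⟩).comp x (hasDerivAt_neg x)
    exact h1.congr_deriv (by ring)

theorem hasDerivAt_of_eqOn_Iic_Ici {f g k : ℝ → ℝ} {a d : ℝ} (hg : HasDerivAt g d a)
    (hk : HasDerivAt k d a) (hfg : ∀ x ≤ a, f x = g x) (hfk : ∀ x, a ≤ x → f x = k x) :
    HasDerivAt f d a := by
  have h1 : HasDerivWithinAt f d (Set.Iic a) a :=
    hg.hasDerivWithinAt.congr (fun x hx => hfg x hx) (hfg a le_rfl)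
  have h2 : HasDerivWithinAt f d (Set.Ici a) a :=
    hk.hasDerivWithinAt.congr (fun x hx => hfk x hx) (hfk a le_rfl)
  have := h1.union h2
  rwa [Set.Iic_union_Ici, hasDerivWithinAt_univ] at this

/-! ### The shape of a pinned fluxon -/

namespace IsPinnedFluxon

variable {L : ℝ} {φ : ℝ → ℝ}

theorem hasDerivAt (hφ : IsPinnedFluxon L 0 0 φ) (x : ℝ) : HasDerivAt φ (deriv φ x) x :=
  (hφ.1.differentiable one_ne_zero x).hasDerivAt

theorem continuous_deriv (hφ : IsPinnedFluxon L 0 0 φ) : Continuous (deriv φ) :=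
  hφ.1.continuous_deriv le_rfl

theorem hasDerivAt_deriv_of_lt (hφ : IsPinnedFluxon L 0 0 φ) (hL : 0 < L) {x : ℝ} (hx : x < -L) :
    HasDerivAt (deriv φ) (Real.sin (φ x)) x := by
  obtain ⟨d, hd, he⟩ := hφ.2.1 x hx.ne (by linarith)
  have : ¬ |x| < L := by
    rw [abs_lt]
    intro h
    linarith [h.1]
  simp only [Dfun, this, if_false] at he
  exact hd.congr_deriv (by linarith)

theorem hasDerivAt_deriv_of_abs_lt (hφ : IsPinnedFluxon L 0 0 φ) {x : ℝ} (hx : |x| < L) :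
    HasDerivAt (deriv φ) 0 x := by
  obtain ⟨h1, h2⟩ := abs_lt.1 hx
  obtain ⟨d, hd, he⟩ := hφ.2.1 x h1.ne' h2.ne
  simp only [Dfun, hx, if_true] at he
  exact hd.congr_deriv (by linarith)

theorem deriv_reflect (hφ : IsPinnedFluxon L 0 0 φ) :
    deriv (fun x => 2 * π - φ (-x)) = fun x => deriv φ (-x) := by
  funext x
  have h := ((hφ.hasDerivAt (-x)).comp x (hasDerivAt_neg x)).const_sub (2 * π)
  rw [show (fun x => 2 * π - φ (-x)) = fun x => 2 * π - (φ ∘ Neg.neg) x from rfl, h.deriv]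
  ring

theorem reflect (hφ : IsPinnedFluxon L 0 0 φ) :
    IsPinnedFluxon L 0 0 (fun x => 2 * π - φ (-x)) := by
  refine ⟨contDiff_const.sub (hφ.1.comp contDiff_neg), ?_, ?_, ?_, ?_, ?_⟩
  · intro x h1 h2
    obtain ⟨d, hd, he⟩ := hφ.2.1 (-x) (by contrapose! h2; linarith) (by contrapose! h1; linarith)
    refine ⟨-d, ?_, ?_⟩
    · rw [hφ.deriv_reflect]
      exact (hd.comp x (hasDerivAt_neg x)).congr_deriv (by ring)
    · rw [Real.sin_two_pi_sub]
      have : Dfun L 0 (-x) = Dfun L 0 x := by simp [Dfun]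
      rw [this] at he
      linarith
  · have := (hφ.2.2.2.1.comp tendsto_neg_atBot_atTop).const_sub (2 * π)
    simpa [Function.comp_def] using this
  · have := (hφ.2.2.1.comp tendsto_neg_atTop_atBot).const_sub (2 * π)
    simpa [Function.comp_def] using this
  · rw [hφ.deriv_reflect]
    exact hφ.2.2.2.2.2.comp tendsto_neg_atBot_atTop
  · rw [hφ.deriv_reflect]
    exact hφ.2.2.2.2.1.comp tendsto_neg_atTop_atBot

theorem hasDerivAt_sin_half (hφ : IsPinnedFluxon L 0 0 φ) (x : ℝ) :
    HasDerivAt (fun x => Real.sin (φ x / 2)) (Real.cos (φ x / 2) * (deriv φ x / 2)) x :=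
  ((hφ.hasDerivAt x).div_const 2).sin

theorem hasDerivAt_cos_half (hφ : IsPinnedFluxon L 0 0 φ) (x : ℝ) :
    HasDerivAt (fun x => Real.cos (φ x / 2)) (-Real.sin (φ x / 2) * (deriv φ x / 2)) x :=
  ((hφ.hasDerivAt x).div_const 2).cos

theorem tendsto_atBot (hφ : IsPinnedFluxon L 0 0 φ) : Tendsto φ atBot (𝓝 0) := by
  simpa using hφ.2.2.1

theorem tendsto_cos_half (hφ : IsPinnedFluxon L 0 0 φ) :
    Tendsto (fun x => Real.cos (φ x / 2)) atBot (𝓝 1) := by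
  have := (Real.continuous_cos.tendsto _).comp (hφ.tendsto_atBot.div_const 2)
  simpa [Function.comp_def] using this

theorem tendsto_sin_half (hφ : IsPinnedFluxon L 0 0 φ) :
    Tendsto (fun x => Real.sin (φ x / 2)) atBot (𝓝 0) := by
  have := (Real.continuous_sin.tendsto _).comp (hφ.tendsto_atBot.div_const 2)
  simpa [Function.comp_def] using this

theorem sin_eq (φ : ℝ → ℝ) (x : ℝ) :
    Real.sin (φ x) = 2 * Real.sin (φ x / 2) * Real.cos (φ x / 2) := by
  rw [← Real.sin_two_mul]
  congr 1
  ring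

/-- The Bogomolny equation satisfied by the left tail. -/
theorem deriv_eq_left (hφ : IsPinnedFluxon L 0 0 φ) (hL : 0 < L) {x : ℝ} (hx : x ≤ -L) :
    deriv φ x = 2 * Real.sin (φ x / 2) := by
  have hc := hφ.continuous_deriv
  have hc0 : Continuous φ := hφ.1.continuous
  set p : ℝ → ℝ := fun x => deriv φ x - 2 * Real.sin (φ x / 2) with hp
  set q : ℝ → ℝ := fun x => deriv φ x + 2 * Real.sin (φ x / 2) with hq
  have hpd : ∀ x < -L, HasDerivAt p (-Real.cos (φ x / 2) * p x) x := fun x hx =>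
    ((hφ.hasDerivAt_deriv_of_lt hL hx).sub ((hφ.hasDerivAt_sin_half x).const_mul 2)).congr_deriv
      (by rw [sin_eq]; simp only [hp]; ring)
  have hqd : ∀ x < -L, HasDerivAt q (Real.cos (φ x / 2) * q x) x := fun x hx =>
    ((hφ.hasDerivAt_deriv_of_lt hL hx).add ((hφ.hasDerivAt_sin_half x).const_mul 2)).congr_deriv
      (by rw [sin_eq]; simp only [hq]; ring)
  have hpc : Continuous p := by fun_prop
  have hqc : Continuous q := by fun_prop
  have hpq : p (-L) * q (-L) = 0 := by
    refine eq_of_deriv_eq_zero_of_tendsto_atBot (f := fun x => p x * q x) (b := -L)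
      (by fun_prop) (fun x hx => ((hpd x hx).mul (hqd x hx)).congr_deriv (by ring)) ?_ le_rfl
    have h1 := hφ.2.2.2.2.1.sub (hφ.tendsto_sin_half.const_mul 2)
    have h2 := hφ.2.2.2.2.1.add (hφ.tendsto_sin_half.const_mul 2)
    simpa [hp, hq] using h1.mul h2
  rcases mul_eq_zero.1 hpq with h | h
  · have := eq_zero_of_linear_backward hx hpc (fun y hy => hpd y hy.2)
      (fun y => by simpa using Real.abs_cos_le_one _) h
    simp only [hp] at this
    linarith
  · have hq0 : ∀ y ≤ -L, q y = 0 := fun y hy => eq_zero_of_linear_backward hy hqc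
      (fun y hy => hqd y hy.2) (fun y => Real.abs_cos_le_one _) h
    have h1 : 1 ≤ Real.cos (φ x / 2) := by
      refine le_of_deriv_nonneg_of_tendsto_atBot (f := fun x => Real.cos (φ x / 2))
        (f' := fun x => Real.sin (φ x / 2) ^ 2) (b := -L) (by fun_prop)
        (fun y hy => (hφ.hasDerivAt_cos_half y).congr_deriv ?_) (fun y _ => sq_nonneg _)
        hφ.tendsto_cos_half hx
      have := hq0 y hy.le
      simp only [hq] at this
      rw [show deriv φ y = -(2 * Real.sin (φ y / 2)) by linarith]
      ring
    have h2 : Real.sin (φ x / 2) = 0 := by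
      have := Real.sin_sq_add_cos_sq (φ x / 2)
      have : Real.sin (φ x / 2) ^ 2 ≤ 0 := by nlinarith
      exact pow_eq_zero_iff two_ne_zero |>.1 (le_antisymm this (sq_nonneg _))
    have := hq0 x hx
    simp only [hq] at this
    linarith

theorem deriv_eq_right (hφ : IsPinnedFluxon L 0 0 φ) (hL : 0 < L) {x : ℝ} (hx : L ≤ x) :
    deriv φ x = 2 * Real.sin (φ x / 2) := by
  have := hφ.reflect.deriv_eq_left hL (neg_le_neg hx)
  rw [hφ.deriv_reflect] at this
  simp only [neg_neg] at this
  rw [this, show (2 * π - φ x) / 2 = π - φ x / 2 by ring, Real.sin_pi_sub]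

theorem sin_half_ne_zero_left (hφ : IsPinnedFluxon L 0 0 φ) (hL : 0 < L)
    (h0 : deriv φ (-L) ≠ 0) {x : ℝ} (hx : x ≤ -L) : Real.sin (φ x / 2) ≠ 0 := by
  have hc0 : Continuous φ := hφ.1.continuous
  intro h
  apply h0
  rw [hφ.deriv_eq_left hL le_rfl]
  have := eq_zero_of_linear_forward (q := fun x => Real.sin (φ x / 2)) hx (by fun_prop)
    (fun y hy => (hφ.hasDerivAt_sin_half y).congr_deriv
      (by rw [hφ.deriv_eq_left hL hy.2.le, mul_div_cancel_left₀ _ (two_ne_zero' ℝ)]))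
    (fun y => Real.abs_cos_le_one _) h
  rw [this, mul_zero]

theorem abs_lt_two_pi_left (hφ : IsPinnedFluxon L 0 0 φ) (hL : 0 < L)
    (h0 : deriv φ (-L) ≠ 0) {x : ℝ} (hx : x ≤ -L) : |φ x| < 2 * π := by
  have hc0 : Continuous fun x => |φ x| := hφ.1.continuous.abs
  by_contra! hcon
  have h1 : ∀ᶠ y in atBot, |φ y| < 2 * π := by
    have := hφ.tendsto_atBot.abs
    rw [abs_zero] at this
    exact this.eventually_lt_const (by positivity)
  obtain ⟨y, hy, hyx⟩ := (h1.and (eventually_le_atBot x)).exists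
  obtain ⟨z, hz, hzv⟩ := intermediate_value_Icc hyx hc0.continuousOn ⟨hy.le, hcon⟩
  apply hφ.sin_half_ne_zero_left hL h0 (hz.2.trans hx)
  rcases (abs_eq (by positivity)).1 hzv with h | h
  · rw [h, mul_div_cancel_left₀ _ (two_ne_zero' ℝ), Real.sin_pi]
  · rw [h, neg_div, mul_div_cancel_left₀ _ (two_ne_zero' ℝ), Real.sin_neg, Real.sin_pi, neg_zero]

theorem deriv_eq_middle (hφ : IsPinnedFluxon L 0 0 φ) {x : ℝ} (hx : x ∈ Set.Icc (-L) L) :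
    deriv φ x = deriv φ (-L) := by
  rcases hx.1.eq_or_lt with h | h
  · rw [← h]
  · obtain ⟨c, -, hc⟩ := exists_hasDerivAt_eq_slope (deriv φ) (fun _ => 0) h
      hφ.continuous_deriv.continuousOn fun y hy =>
        hφ.hasDerivAt_deriv_of_abs_lt (abs_lt.2 ⟨hy.1, hy.2.trans_le hx.2⟩)
    have : x - -L ≠ 0 := (sub_pos.2 h).ne'
    field_simp at hc
    linarith

theorem apply_right_sub_apply_left (hφ : IsPinnedFluxon L 0 0 φ) (hL : 0 < L) :
    φ L - φ (-L) = 2 * L * deriv φ (-L) := by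
  obtain ⟨c, hc, he⟩ := exists_hasDerivAt_eq_slope φ (deriv φ) (show -L < L by linarith)
    hφ.1.continuous.continuousOn fun y _ => hφ.hasDerivAt y
  rw [hφ.deriv_eq_middle ⟨hc.1.le, hc.2.le⟩] at he
  rw [he]
  field_simp
  ring

theorem apply_left_eq_zero (hφ : IsPinnedFluxon L 0 0 φ) (hL : 0 < L) (h0 : deriv φ (-L) = 0) :
    φ (-L) = 0 := by
  have hc0 : Continuous φ := hφ.1.continuous
  have hs : Real.sin (φ (-L) / 2) = 0 := by
    rw [hφ.deriv_eq_left hL le_rfl] at h0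
    linarith
  refine eq_of_deriv_eq_zero_of_tendsto_atBot hc0.continuousOn (fun x hx => ?_)
    hφ.tendsto_atBot le_rfl
  have := eq_zero_of_linear_backward (q := fun x => Real.sin (φ x / 2)) hx.le (by fun_prop)
    (fun y hy => (hφ.hasDerivAt_sin_half y).congr_deriv
      (by rw [hφ.deriv_eq_left hL hy.2.le, mul_div_cancel_left₀ _ (two_ne_zero' ℝ)]))
    (fun y => Real.abs_cos_le_one _) hs
  exact (hφ.hasDerivAt x).congr_deriv (by rw [hφ.deriv_eq_left hL hx.le, this, mul_zero])

theorem deriv_left_ne_zero (hφ : IsPinnedFluxon L 0 0 φ) (hL : 0 < L) : deriv φ (-L) ≠ 0 := by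
  intro h0
  have h1 := hφ.apply_left_eq_zero hL h0
  have h2 := hφ.reflect.apply_left_eq_zero hL (by
    rw [hφ.deriv_reflect]
    simp only [neg_neg]
    rw [hφ.deriv_eq_middle ⟨by linarith, le_rfl⟩, h0])
  have h3 := hφ.apply_right_sub_apply_left hL
  simp only [neg_neg] at h2
  rw [h0, h1] at h3
  have := Real.pi_pos
  linarith

/-- The values of the fluxon at the edges of the inhomogeneity. -/
theorem edge_values (hφ : IsPinnedFluxon L 0 0 φ) (hL : 0 < L) :
    φ L = 2 * π - φ (-L) ∧ φ (-L) ∈ Set.Ioo 0 π ∧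
      π - φ (-L) = 2 * L * Real.sin (φ (-L) / 2) := by
  have hne := hφ.deriv_left_ne_zero hL
  have hLR : deriv φ L = deriv φ (-L) := hφ.deriv_eq_middle ⟨by linarith, le_rfl⟩
  have hα := abs_lt.1 (hφ.abs_lt_two_pi_left hL hne le_rfl)
  have hβ := abs_lt.1 (hφ.reflect.abs_lt_two_pi_left hL (x := -L) (by
    rw [hφ.deriv_reflect]
    simp only [neg_neg]
    rwa [hLR]) le_rfl)
  simp only [neg_neg] at hβ
  have hk := hφ.deriv_eq_left hL le_rfl
  have hk' := hφ.deriv_eq_right hL le_rfl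
  rw [hLR] at hk'
  have hd := hφ.apply_right_sub_apply_left hL
  set α := φ (-L)
  set β := φ L
  set k := deriv φ (-L)
  have hαpos : 0 < α := by
    by_contra! h
    have h1 : Real.sin (α / 2) ≤ 0 :=
      Real.sin_nonpos_of_nonpos_of_neg_pi_le (by linarith) (by linarith [hα.1])
    have : L * k ≤ 0 := mul_nonpos_of_nonneg_of_nonpos hL.le (by linarith)
    linarith [hβ.2]
  have hsin : 0 < Real.sin (α / 2) := Real.sin_pos_of_pos_of_lt_pi (by linarith) (by linarith [hα.2])
  have hαβ : α < β := by
    have : 0 < L * k := mul_pos hL (by linarith)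
    linarith
  have hβ2 : β < 2 * π := by
    by_contra! h
    have h1 : Real.sin (β / 2 - 2 * π) ≤ 0 :=
      Real.sin_nonpos_of_nonpos_of_neg_pi_le (by linarith [hβ.1]) (by linarith)
    rw [Real.sin_sub_two_pi] at h1
    linarith
  have hsum : Real.sin (β / 2) - Real.sin (α / 2) = 0 := by linarith
  rw [Real.sin_sub_sin] at hsum
  have h1 : 0 < Real.sin ((β / 2 - α / 2) / 2) :=
    Real.sin_pos_of_pos_of_lt_pi (by linarith) (by linarith)
  have h2 : Real.cos ((β / 2 + α / 2) / 2) = Real.cos (π / 2) := by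
    rw [Real.cos_pi_div_two]
    by_contra h
    exact mul_ne_zero (mul_ne_zero two_ne_zero h1.ne') h hsum
  have h3 := Real.injOn_cos ⟨by linarith, by linarith⟩
    ⟨by linarith [Real.pi_pos], by linarith [Real.pi_pos]⟩ h2
  have h4 : β = 2 * π - α := by linarith
  refine ⟨h4, ⟨hαpos, by linarith⟩, ?_⟩
  rw [hk, h4] at hd
  linarith

theorem cos_half_le_left (hφ : IsPinnedFluxon L 0 0 φ) (hL : 0 < L) {x : ℝ} (hx : x ≤ -L) :
    Real.cos (φ (-L) / 2) ≤ Real.cos (φ x / 2) := by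
  have hc0 : Continuous φ := hφ.1.continuous
  refine antitoneOn_of_hasDerivWithinAt_nonpos (f := fun x => Real.cos (φ x / 2))
    (f' := fun x => -Real.sin (φ x / 2) ^ 2) (convex_Iic (-L)) (by fun_prop) (fun y hy => ?_)
    (fun y _ => neg_nonpos.2 (sq_nonneg _)) hx (Set.mem_Iic.2 le_rfl) hx
  rw [interior_Iic] at hy
  refine ((hφ.hasDerivAt_cos_half y).congr_deriv ?_).hasDerivWithinAt
  rw [hφ.deriv_eq_left hL (le_of_lt hy)]
  ring

theorem cos_half_right_le (hφ : IsPinnedFluxon L 0 0 φ) (hL : 0 < L) {x : ℝ} (hx : L ≤ x) :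
    Real.cos (φ x / 2) ≤ Real.cos (φ L / 2) := by
  have := hφ.reflect.cos_half_le_left hL (neg_le_neg hx)
  simp only [neg_neg] at this
  simp only [show ∀ y, (2 * π - y) / 2 = π - y / 2 from fun y => by ring, Real.cos_pi_sub] at this
  linarith

end IsPinnedFluxon

/-! ### The ground state of the linearisation -/

/-- Solution of the linearised equation along a kink tail, growing like `exp (ν x)`. -/
noncomputable def kinkTail (φ : ℝ → ℝ) (ν x₀ x : ℝ) : ℝ :=
  Real.exp (ν * (x - x₀)) * (ν + Real.cos (φ x / 2))

/-- The derivative of `kinkTail`. -/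
noncomputable def kinkTailDeriv (φ : ℝ → ℝ) (ν x₀ x : ℝ) : ℝ :=
  Real.exp (ν * (x - x₀)) * (ν * (ν + Real.cos (φ x / 2)) - Real.sin (φ x / 2) ^ 2)

theorem hasDerivAt_exp_shift (ν x₀ x : ℝ) :
    HasDerivAt (fun x => Real.exp (ν * (x - x₀))) (Real.exp (ν * (x - x₀)) * ν) x := by
  simpa using (((hasDerivAt_id x).sub_const x₀).const_mul ν).exp

theorem IsPinnedFluxon.hasDerivAt_kinkTail {L : ℝ} {φ : ℝ → ℝ} (hφ : IsPinnedFluxon L 0 0 φ)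
    {x : ℝ} (hx : deriv φ x = 2 * Real.sin (φ x / 2)) (ν x₀ : ℝ) :
    HasDerivAt (kinkTail φ ν x₀) (kinkTailDeriv φ ν x₀ x) x := by
  refine ((hasDerivAt_exp_shift ν x₀ x).mul
    ((hφ.hasDerivAt_cos_half x).const_add ν)).congr_deriv ?_
  rw [hx, kinkTailDeriv]
  ring

theorem IsPinnedFluxon.hasDerivAt_kinkTailDeriv {L : ℝ} {φ : ℝ → ℝ} (hφ : IsPinnedFluxon L 0 0 φ)
    {x : ℝ} (hx : deriv φ x = 2 * Real.sin (φ x / 2)) (ν x₀ : ℝ) :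
    HasDerivAt (kinkTailDeriv φ ν x₀)
      ((Real.cos (φ x) + (ν ^ 2 - 1)) * kinkTail φ ν x₀ x) x := by
  refine ((hasDerivAt_exp_shift ν x₀ x).mul
    ((((hφ.hasDerivAt_cos_half x).const_add ν).const_mul ν).sub
      ((hφ.hasDerivAt_sin_half x).pow 2))).congr_deriv ?_
  have h : Real.cos (φ x) = 1 - 2 * Real.sin (φ x / 2) ^ 2 := by
    have h1 := Real.cos_two_mul (φ x / 2)
    rw [show 2 * (φ x / 2) = φ x by ring] at h1
    linarith [Real.sin_sq_add_cos_sq (φ x / 2)]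
  rw [hx, kinkTail, h]
  simp only [Pi.pow_apply, Pi.sub_apply]
  push_cast
  ring

theorem continuous_kinkTailDeriv {φ : ℝ → ℝ} (hφ : Continuous φ) (ν x₀ : ℝ) :
    Continuous (kinkTailDeriv φ ν x₀) := by
  unfold kinkTailDeriv
  fun_prop

/-- The function equal to `f` on `(-∞, -L]`, to `g` on `(-L, L]` and to `k` on `(L, ∞)`. -/
noncomputable def glue (L : ℝ) (f g k : ℝ → ℝ) (x : ℝ) : ℝ :=
  if x ≤ -L then f x else if x ≤ L then g x else k x

section glue

variable {L : ℝ} {f g k : ℝ → ℝ}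

theorem glue_left {x : ℝ} (hx : x ≤ -L) : glue L f g k x = f x := if_pos hx

theorem glue_middle (hfg : f (-L) = g (-L)) {x : ℝ} (h1 : -L ≤ x) (h2 : x ≤ L) :
    glue L f g k x = g x := by
  rcases h1.eq_or_lt with rfl | h
  · rw [glue_left le_rfl, hfg]
  · rw [glue, if_neg h.not_ge, if_pos h2]

theorem glue_right (hL : 0 < L) (hgk : g L = k L) {x : ℝ} (hx : L ≤ x) :
    glue L f g k x = k x := by
  have h1 : ¬ x ≤ -L := by linarith
  rw [glue, if_neg h1]
  rcases hx.eq_or_lt with rfl | h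
  · rw [if_pos le_rfl, hgk]
  · rw [if_neg h.not_ge]

theorem glue_eventuallyEq_left {x : ℝ} (hx : x < -L) : glue L f g k =ᶠ[𝓝 x] f := by
  filter_upwards [Iio_mem_nhds hx] with y hy using glue_left (le_of_lt hy)

theorem glue_eventuallyEq_middle (hfg : f (-L) = g (-L)) {x : ℝ} (hx : x ∈ Set.Ioo (-L) L) :
    glue L f g k =ᶠ[𝓝 x] g := by
  filter_upwards [Ioo_mem_nhds hx.1 hx.2] with y hy using glue_middle hfg hy.1.le hy.2.le

theorem glue_eventuallyEq_right (hL : 0 < L) (hgk : g L = k L) {x : ℝ} (hx : L < x) :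
    glue L f g k =ᶠ[𝓝 x] k := by
  filter_upwards [Ioi_mem_nhds hx] with y hy using glue_right hL hgk (le_of_lt hy)

theorem continuous_glue (hL : 0 < L) (hf : Continuous f) (hg : Continuous g) (hk : Continuous k)
    (hfg : f (-L) = g (-L)) (hgk : g L = k L) : Continuous (glue L f g k) := by
  refine Continuous.if_le hf (Continuous.if_le hg hk continuous_id continuous_const ?_)
    continuous_id continuous_const ?_
  · rintro x rfl
    exact hgk
  · rintro x rfl
    rw [if_pos (by linarith), hfg]

theorem hasDerivAt_glue {f' g' k' : ℝ → ℝ} (hL : 0 < L)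
    (hf : ∀ x ≤ -L, HasDerivAt f (f' x) x) (hg : ∀ x, HasDerivAt g (g' x) x)
    (hk : ∀ x, L ≤ x → HasDerivAt k (k' x) x) (hfg : f (-L) = g (-L)) (hgk : g L = k L)
    (hfg' : f' (-L) = g' (-L)) (hgk' : g' L = k' L) (x : ℝ) :
    HasDerivAt (glue L f g k) (glue L f' g' k' x) x := by
  rcases lt_trichotomy x (-L) with h | rfl | h
  · rw [glue_left h.le]
    exact (hf x h.le).congr_of_eventuallyEq (glue_eventuallyEq_left h)
  · rw [glue_left le_rfl]
    have h : HasDerivAt (fun x => if x ≤ -L then f x else g x) (f' (-L)) (-L) :=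
      hasDerivAt_of_eqOn_Iic_Ici (hf _ le_rfl) (hfg' ▸ hg (-L)) (fun y hy => if_pos hy)
        fun y hy => by
          rcases hy.eq_or_lt with rfl | hy
          · rw [if_pos le_rfl, hfg]
          · exact if_neg hy.not_ge
    refine h.congr_of_eventuallyEq ?_
    filter_upwards [Iio_mem_nhds (show -L < L by linarith)] with y hy
    simp only [glue, if_pos (le_of_lt (Set.mem_Iio.1 hy))]
  · rcases lt_trichotomy x L with h2 | rfl | h2
    · rw [glue_middle hfg' h.le h2.le]
      exact (hg x).congr_of_eventuallyEq (glue_eventuallyEq_middle hfg ⟨h, h2⟩)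
    · rw [glue_middle hfg' h.le le_rfl]
      have h' : HasDerivAt (fun y => if y ≤ x then g y else k y) (g' x) x :=
        hasDerivAt_of_eqOn_Iic_Ici (hg x) (hgk' ▸ hk x le_rfl) (fun y hy => if_pos hy)
          fun y hy => by
            rcases hy.eq_or_lt with rfl | hy
            · rw [if_pos le_rfl, hgk]
            · exact if_neg hy.not_ge
      refine h'.congr_of_eventuallyEq ?_
      filter_upwards [Ioi_mem_nhds h] with y hy
      rw [glue, if_neg (not_le.2 hy)]
    · rw [glue_right hL hgk' h2.le]
      exact (hk x h2.le).congr_of_eventuallyEq (glue_eventuallyEq_right hL hgk h2)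

end glue

/-- Parameters for which a trigonometric interior solution matches the two kink tails. -/
structure IsMatched (L : ℝ) (φ : ℝ → ℝ) (μ ω A : ℝ) : Prop where
  fluxon : IsPinnedFluxon L 0 0 φ
  L_pos : 0 < L
  mu_pos : 0 < μ
  omega_pos : 0 < ω
  A_pos : 0 < A
  sq_add_sq : μ ^ 2 + ω ^ 2 = 1
  omega_mul_lt : ω * L < π / 2
  value : A * (μ + Real.cos (φ (-L) / 2)) = Real.cos (ω * L)
  slope : A * (μ * (μ + Real.cos (φ (-L) / 2)) - Real.sin (φ (-L) / 2) ^ 2) =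
    ω * Real.sin (ω * L)

/-- The positive even eigenfunction. -/
noncomputable def groundState (L : ℝ) (φ : ℝ → ℝ) (μ ω A : ℝ) : ℝ → ℝ :=
  glue L (fun x => A * kinkTail φ μ (-L) x) (fun x => Real.cos (ω * x))
    (fun x => -A * kinkTail φ (-μ) L x)

/-- The derivative of `groundState`. -/
noncomputable def groundStateDeriv (L : ℝ) (φ : ℝ → ℝ) (μ ω A : ℝ) : ℝ → ℝ :=
  glue L (fun x => A * kinkTailDeriv φ μ (-L) x) (fun x => -ω * Real.sin (ω * x))
    (fun x => -A * kinkTailDeriv φ (-μ) L x)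

namespace IsMatched

variable {L : ℝ} {φ : ℝ → ℝ} {μ ω A : ℝ}

theorem cos_half_left_pos (hm : IsMatched L φ μ ω A) : 0 < Real.cos (φ (-L) / 2) := by
  obtain ⟨-, h, -⟩ := hm.fluxon.edge_values hm.L_pos
  exact Real.cos_pos_of_mem_Ioo ⟨by linarith [h.1, Real.pi_pos], by linarith [h.2]⟩

theorem half_right (hm : IsMatched L φ μ ω A) : φ L / 2 = π - φ (-L) / 2 := by
  rw [(hm.fluxon.edge_values hm.L_pos).1]
  ring

theorem value_left (hm : IsMatched L φ μ ω A) :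
    A * kinkTail φ μ (-L) (-L) = Real.cos (ω * -L) := by
  simp [kinkTail, hm.value]

theorem value_right (hm : IsMatched L φ μ ω A) :
    Real.cos (ω * L) = -A * kinkTail φ (-μ) L L := by
  rw [kinkTail, hm.half_right, Real.cos_pi_sub, ← hm.value, sub_self, mul_zero, Real.exp_zero]
  ring

theorem slope_left (hm : IsMatched L φ μ ω A) :
    A * kinkTailDeriv φ μ (-L) (-L) = -ω * Real.sin (ω * -L) := by
  simp [kinkTailDeriv, hm.slope]

theorem slope_right (hm : IsMatched L φ μ ω A) :
    -ω * Real.sin (ω * L) = -A * kinkTailDeriv φ (-μ) L L := by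
  rw [kinkTailDeriv, hm.half_right, Real.cos_pi_sub, Real.sin_pi_sub, neg_mul, ← hm.slope, sub_self, mul_zero,
    Real.exp_zero]
  ring

theorem hasDerivAt_groundState (hm : IsMatched L φ μ ω A) (x : ℝ) :
    HasDerivAt (groundState L φ μ ω A) (groundStateDeriv L φ μ ω A x) x := by
  refine hasDerivAt_glue (f' := fun x => A * kinkTailDeriv φ μ (-L) x)
    (g' := fun x => -ω * Real.sin (ω * x)) (k' := fun x => -A * kinkTailDeriv φ (-μ) L x) hm.L_pos
    (fun y hy => ?_) (fun y => ?_) (fun y hy => ?_) hm.value_left hm.value_right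
    hm.slope_left hm.slope_right x
  · exact (hm.fluxon.hasDerivAt_kinkTail (hm.fluxon.deriv_eq_left hm.L_pos hy) _ _).const_mul A
  · exact ((hasDerivAt_id y).const_mul ω).cos.congr_deriv (by simp; ring)
  · exact (hm.fluxon.hasDerivAt_kinkTail (hm.fluxon.deriv_eq_right hm.L_pos hy) _ _).const_mul _

theorem deriv_groundState (hm : IsMatched L φ μ ω A) :
    deriv (groundState L φ μ ω A) = groundStateDeriv L φ μ ω A :=
  funext fun x => (hm.hasDerivAt_groundState x).deriv

theorem continuous_groundState (hm : IsMatched L φ μ ω A) :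
    Continuous (groundState L φ μ ω A) :=
  continuous_iff_continuousAt.2 fun x => (hm.hasDerivAt_groundState x).continuousAt

theorem continuous_groundStateDeriv (hm : IsMatched L φ μ ω A) :
    Continuous (groundStateDeriv L φ μ ω A) :=
  continuous_glue hm.L_pos
    (continuous_const.mul (continuous_kinkTailDeriv hm.fluxon.1.continuous _ _)) (by fun_prop)
    (continuous_const.mul (continuous_kinkTailDeriv hm.fluxon.1.continuous _ _))
    hm.slope_left hm.slope_right

theorem hasDerivAt_groundStateDeriv (hm : IsMatched L φ μ ω A) {x : ℝ} (h1 : x ≠ -L)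
    (h2 : x ≠ L) :
    HasDerivAt (groundStateDeriv L φ μ ω A)
      ((Dfun L 0 x * Real.cos (φ x) + (μ ^ 2 - 1)) * groundState L φ μ ω A x) x := by
  have hL := hm.L_pos
  rcases h1.lt_or_gt with h | h
  · have hD : Dfun L 0 x = 1 := if_neg fun hx => by linarith [(abs_lt.1 hx).1]
    rw [hD, groundState, glue_left h.le]
    refine HasDerivAt.congr_of_eventuallyEq ?_ (glue_eventuallyEq_left h)
    exact ((hm.fluxon.hasDerivAt_kinkTailDeriv (hm.fluxon.deriv_eq_left hm.L_pos h.le)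
      _ _).const_mul A).congr_deriv (by ring)
  rcases h2.lt_or_gt with h' | h'
  · have hD : Dfun L 0 x = 0 := if_pos (abs_lt.2 ⟨h, h'⟩)
    rw [hD, groundState, glue_middle hm.value_left h.le h'.le]
    refine HasDerivAt.congr_of_eventuallyEq ?_ (glue_eventuallyEq_middle hm.slope_left ⟨h, h'⟩)
    refine (((hasDerivAt_id x).const_mul ω).sin.const_mul (-ω)).congr_deriv ?_
    rw [show μ ^ 2 - 1 = -ω ^ 2 by linarith [hm.sq_add_sq]]
    simp
    ring
  · have hD : Dfun L 0 x = 1 := if_neg fun hx => by linarith [(abs_lt.1 hx).2]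
    rw [hD, groundState, glue_right hL hm.value_right h'.le]
    refine HasDerivAt.congr_of_eventuallyEq ?_ (glue_eventuallyEq_right hL hm.slope_right h')
    exact ((hm.fluxon.hasDerivAt_kinkTailDeriv (hm.fluxon.deriv_eq_right hm.L_pos h'.le)
      _ _).const_mul _).congr_deriv (by ring)

theorem add_cos_half_left_pos (hm : IsMatched L φ μ ω A) {x : ℝ} (hx : x ≤ -L) :
    μ < μ + Real.cos (φ x / 2) := by
  linarith [hm.fluxon.cos_half_le_left hm.L_pos hx, hm.cos_half_left_pos]

theorem add_cos_half_right_neg (hm : IsMatched L φ μ ω A) {x : ℝ} (hx : L ≤ x) :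
    -μ + Real.cos (φ x / 2) < -μ := by
  have := hm.fluxon.cos_half_right_le hm.L_pos hx
  rw [hm.half_right, Real.cos_pi_sub] at this
  linarith [hm.cos_half_left_pos]

theorem groundState_pos (hm : IsMatched L φ μ ω A) (x : ℝ) : 0 < groundState L φ μ ω A x := by
  have hμ := hm.mu_pos
  rcases le_total x (-L) with h | h
  · rw [groundState, glue_left h]
    have := hm.add_cos_half_left_pos h
    exact mul_pos hm.A_pos (mul_pos (Real.exp_pos _) (by linarith))
  rcases le_total x L with h' | h'
  · rw [groundState, glue_middle hm.value_left h h']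
    have hω := hm.omega_pos
    have h1 : ω * x ≤ ω * L := by gcongr
    have h2 : ω * -L ≤ ω * x := by gcongr
    exact Real.cos_pos_of_mem_Ioo ⟨by linarith [hm.omega_mul_lt], by linarith [hm.omega_mul_lt]⟩
  · rw [groundState, glue_right hm.L_pos hm.value_right h']
    have := hm.add_cos_half_right_neg h'
    have h1 := mul_pos hm.A_pos (mul_pos (Real.exp_pos (-μ * (x - L)))
      (show 0 < -(-μ + Real.cos (φ x / 2)) by linarith))
    rw [kinkTail]
    linarith

end IsMatched

theorem abs_kinkTailDeriv_le {φ : ℝ → ℝ} {ν x₀ x : ℝ} (hν : ν ≠ 0)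
    (h : |ν| ≤ |ν + Real.cos (φ x / 2)|) :
    |kinkTailDeriv φ ν x₀ x| ≤ (|ν| + |ν|⁻¹) * |kinkTail φ ν x₀ x| := by
  rw [kinkTailDeriv, kinkTail, abs_mul, abs_mul, mul_left_comm]
  refine mul_le_mul_of_nonneg_left ?_ (abs_nonneg _)
  have hs : |Real.sin (φ x / 2) ^ 2| ≤ 1 := by
    rw [abs_of_nonneg (sq_nonneg _)]
    exact Real.sin_sq_le_one _
  have h1 : (1 : ℝ) ≤ |ν|⁻¹ * |ν + Real.cos (φ x / 2)| := by
    rw [← div_eq_inv_mul, one_le_div (abs_pos.2 hν)]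
    exact h
  have h2 := abs_sub (ν * (ν + Real.cos (φ x / 2))) (Real.sin (φ x / 2) ^ 2)
  rw [abs_mul] at h2
  linarith

theorem abs_kinkTail_le (φ : ℝ → ℝ) (ν x₀ x : ℝ) :
    |kinkTail φ ν x₀ x| ≤ Real.exp (ν * (x - x₀)) * (|ν| + 1) := by
  rw [kinkTail, abs_mul, abs_of_pos (Real.exp_pos _)]
  refine mul_le_mul_of_nonneg_left ?_ (Real.exp_pos _).le
  exact (abs_add_le _ _).trans (by linarith [Real.abs_cos_le_one (φ x / 2)])

theorem tendsto_kinkTail {l : Filter ℝ} (φ : ℝ → ℝ) {ν x₀ : ℝ}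
    (h : Tendsto (fun x => ν * (x - x₀)) l atBot) : Tendsto (kinkTail φ ν x₀) l (𝓝 0) := by
  refine squeeze_zero_norm (fun x => abs_kinkTail_le φ ν x₀ x) ?_
  simpa using (Real.tendsto_exp_atBot.comp h).mul_const (|ν| + 1)

namespace IsMatched

variable {L : ℝ} {φ : ℝ → ℝ} {μ ω A : ℝ}

theorem abs_groundStateDeriv_le (hm : IsMatched L φ μ ω A) {x : ℝ} (hx : x ≤ -L ∨ L ≤ x) :
    |groundStateDeriv L φ μ ω A x| ≤ (|μ| + |μ|⁻¹) * groundState L φ μ ω A x := by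
  have hμ := hm.mu_pos
  rw [← abs_of_pos (hm.groundState_pos x)]
  rcases hx with hx | hx
  · rw [groundState, groundStateDeriv, glue_left hx, glue_left hx, abs_mul, abs_mul, mul_left_comm]
    refine mul_le_mul_of_nonneg_left (abs_kinkTailDeriv_le hμ.ne' ?_) (abs_nonneg _)
    have := hm.add_cos_half_left_pos hx
    rw [abs_of_pos hμ, abs_of_pos (by linarith)]
    exact this.le
  · rw [groundState, groundStateDeriv, glue_right hm.L_pos hm.slope_right hx,
      glue_right hm.L_pos hm.value_right hx, abs_mul, abs_mul, mul_left_comm, ← abs_neg μ]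
    refine mul_le_mul_of_nonneg_left (abs_kinkTailDeriv_le (by linarith) ?_) (abs_nonneg _)
    have := hm.add_cos_half_right_neg hx
    rw [abs_of_neg (neg_lt_zero.2 hμ), abs_of_neg (by linarith)]
    linarith

theorem tendsto_groundState_atBot (hm : IsMatched L φ μ ω A) :
    Tendsto (groundState L φ μ ω A) atBot (𝓝 0) := by
  have h : Tendsto (fun x => μ * (x - -L)) atBot atBot :=
    (tendsto_atBot_add_const_right _ _ tendsto_id).const_mul_atBot hm.mu_pos
  have h1 := (tendsto_kinkTail φ h).const_mul A
  rw [mul_zero] at h1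
  refine h1.congr' ?_
  filter_upwards [eventually_le_atBot (-L)] with x hx
  rw [groundState, glue_left hx]

theorem tendsto_groundState_atTop (hm : IsMatched L φ μ ω A) :
    Tendsto (groundState L φ μ ω A) atTop (𝓝 0) := by
  have h : Tendsto (fun x => -μ * (x - L)) atTop atBot :=
    (tendsto_atTop_add_const_right _ _ tendsto_id).const_mul_atTop_of_neg
      (neg_lt_zero.2 hm.mu_pos)
  have h1 := (tendsto_kinkTail φ h).const_mul (-A)
  rw [mul_zero] at h1
  refine h1.congr' ?_
  filter_upwards [eventually_ge_atTop L] with x hx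
  rw [groundState, glue_right hm.L_pos hm.value_right hx]

theorem tendsto_groundStateDeriv (hm : IsMatched L φ μ ω A) {l : Filter ℝ}
    (hl : ∀ᶠ x in l, x ≤ -L ∨ L ≤ x) (h : Tendsto (groundState L φ μ ω A) l (𝓝 0)) :
    Tendsto (groundStateDeriv L φ μ ω A) l (𝓝 0) := by
  refine squeeze_zero_norm' (hl.mono fun x hx => hm.abs_groundStateDeriv_le hx) ?_
  simpa using h.const_mul (|μ| + |μ|⁻¹)

theorem isEigenvalue (hm : IsMatched L φ μ ω A) : IsEigenvalue L 0 0 φ (μ ^ 2 - 1) := by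
  refine ⟨groundState L φ μ ω A, ?_, ?_, ?_, hm.tendsto_groundState_atBot,
    hm.tendsto_groundState_atTop, ?_, ?_⟩
  · intro h
    have := hm.groundState_pos 0
    rw [h] at this
    exact lt_irrefl _ this
  · rw [contDiff_one_iff_deriv, hm.deriv_groundState]
    exact ⟨fun x => (hm.hasDerivAt_groundState x).differentiableAt,
      hm.continuous_groundStateDeriv⟩
  · intro x h1 h2
    rw [hm.deriv_groundState]
    exact ⟨_, hm.hasDerivAt_groundStateDeriv h1 h2, by ring⟩
  · rw [hm.deriv_groundState]
    exact hm.tendsto_groundStateDeriv ((eventually_le_atBot (-L)).mono fun _ => Or.inl)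
      hm.tendsto_groundState_atBot
  · rw [hm.deriv_groundState]
    exact hm.tendsto_groundStateDeriv ((eventually_ge_atTop L).mono fun _ => Or.inr)
      hm.tendsto_groundState_atTop

/-- Picone's identity against the ground state bounds every other eigenvalue. -/
theorem eigenvalue_le (hm : IsMatched L φ μ ω A) {Λ : ℝ} (hΛ : IsEigenvalue L 0 0 φ Λ) :
    Λ ≤ μ ^ 2 - 1 := by
  obtain ⟨ψ, hne, hψ, hode, hb, ht, hb', ht'⟩ := hΛ
  by_contra! hlt
  have hL := hm.L_pos
  set G := groundState L φ μ ω A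
  set G' := groundStateDeriv L φ μ ω A
  have hGpos : ∀ x, 0 < G x := hm.groundState_pos
  have hψd : ∀ x, HasDerivAt ψ (deriv ψ x) x := fun x =>
    (hψ.differentiable one_ne_zero x).hasDerivAt
  set P : ℝ → ℝ := fun x => ψ x * (deriv ψ x - G' x / G x * ψ x) with hP
  set P' : ℝ → ℝ := fun x => (deriv ψ x - G' x / G x * ψ x) ^ 2 + (Λ - (μ ^ 2 - 1)) * ψ x ^ 2
    with hP'
  have hPd : ∀ x, x ≠ -L → x ≠ L → HasDerivAt P (P' x) x := by
    intro x h1 h2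
    obtain ⟨d, hd, he⟩ := hode x h1 h2
    have hG := (hGpos x).ne'
    refine ((hψd x).mul (hd.sub (((hm.hasDerivAt_groundStateDeriv h1 h2).div
      (hm.hasDerivAt_groundState x) hG).mul (hψd x)))).congr_deriv ?_
    rw [show d = (Dfun L 0 x * Real.cos (φ x) + Λ) * ψ x by linarith]
    simp only [hP', Pi.sub_apply, Pi.mul_apply, Pi.div_apply]
    change deriv ψ x * (deriv ψ x - G' x / G x * ψ x) + ψ x * (_ - (
      ((Dfun L 0 x * Real.cos (φ x) + (μ ^ 2 - 1)) * G x * G x - G' x * G' x) / G x ^ 2 * ψ x +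
        G' x / G x * deriv ψ x)) = _
    field_simp
    ring
  have hPc : Continuous P := hψ.continuous.mul ((hψ.continuous_deriv le_rfl).sub
    ((hm.continuous_groundStateDeriv.div hm.continuous_groundState fun x => (hGpos x).ne').mul
      hψ.continuous))
  have hmono : Monotone P := monotone_of_deriv_nonneg_off (by linarith) hPc hPd fun x _ _ =>
    add_nonneg (sq_nonneg _) (mul_nonneg (by linarith) (sq_nonneg _))
  have hlim : ∀ l : Filter ℝ, (∀ᶠ x in l, x ≤ -L ∨ L ≤ x) → Tendsto ψ l (𝓝 0) →
      Tendsto (deriv ψ) l (𝓝 0) → Tendsto P l (𝓝 0) := by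
    intro l hl h1 h2
    refine squeeze_zero_norm' (a := fun x => |ψ x| * (|deriv ψ x| + (|μ| + |μ|⁻¹) * |ψ x|))
      (hl.mono fun x hx => ?_) ?_
    · rw [Real.norm_eq_abs, hP, abs_mul]
      refine mul_le_mul_of_nonneg_left ((abs_sub _ _).trans ?_) (abs_nonneg _)
      rw [abs_mul, abs_div, abs_of_pos (hGpos x)]
      gcongr
      rw [div_le_iff₀ (hGpos x)]
      exact hm.abs_groundStateDeriv_le hx
    · simpa using h1.abs.mul (h2.abs.add (h1.abs.const_mul (|μ| + |μ|⁻¹)))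
  have hP0 : ∀ x, P x = 0 := fun x => le_antisymm
    (hmono.ge_of_tendsto (hlim atTop ((eventually_ge_atTop L).mono fun _ => Or.inr) ht ht') x)
    (hmono.le_of_tendsto (hlim atBot ((eventually_le_atBot (-L)).mono fun _ => Or.inl) hb hb') x)
  have hψ0 : ∀ x, x ≠ -L → x ≠ L → ψ x = 0 := by
    intro x h1 h2
    have h3 := (hPd x h1 h2).unique
      ((hasDerivAt_const x (0 : ℝ)).congr_of_eventuallyEq (Eventually.of_forall hP0))
    have h4 := sq_nonneg (deriv ψ x - G' x / G x * ψ x)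
    have h5 : (Λ - (μ ^ 2 - 1)) * ψ x ^ 2 ≤ 0 := by
      simp only [hP'] at h3
      linarith
    have h6 : ψ x ^ 2 ≤ 0 := nonpos_of_mul_nonpos_right h5 (by linarith)
    exact pow_eq_zero_iff two_ne_zero |>.1 (le_antisymm h6 (sq_nonneg _))
  apply hne
  have hdense : Dense ({-L, L}ᶜ : Set ℝ) := (Set.toFinite {-L, L}).countable.dense_compl ℝ
  refine hψ.continuous.ext_on hdense continuous_zero fun x hx => ?_
  simp only [Set.mem_compl_iff, Set.mem_insert_iff, Set.mem_singleton_iff, not_or] at hx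
  exact hψ0 x hx.1 hx.2

end IsMatched

/-! ### The implicit equation -/

theorem edge_unique {L a b : ℝ} (hL : 0 < L) (ha : a ∈ Set.Ioo 0 π) (hb : b ∈ Set.Ioo 0 π)
    (h1 : π - a = 2 * L * Real.sin (a / 2)) (h2 : π - b = 2 * L * Real.sin (b / 2)) : a = b := by
  have key : ∀ a b : ℝ, a ∈ Set.Ioo 0 π → b ∈ Set.Ioo 0 π → π - a = 2 * L * Real.sin (a / 2) →
      π - b = 2 * L * Real.sin (b / 2) → ¬ a < b := by
    intro a b ha hb h1 h2 hab
    have := Real.sin_lt_sin_of_lt_of_le_pi_div_two (x := a / 2) (y := b / 2)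
      (by linarith [ha.1, Real.pi_pos]) (by linarith [hb.2]) (by linarith)
    have := mul_lt_mul_of_pos_left this (show 0 < 2 * L by linarith)
    linarith
  exact le_antisymm (not_lt.1 (key b a hb ha h2 h1)) (not_lt.1 (key a b ha hb h1 h2))

theorem sin_half_arccos {h : ℝ} (hh : h ∈ Set.Ioo (0 : ℝ) 2) :
    Real.sqrt (2 * h) = 2 * Real.sin (Real.arccos (1 - h) / 2) := by
  have h0 := Real.arccos_nonneg (1 - h)
  have h1 := Real.arccos_le_pi (1 - h)
  have hs : 0 ≤ Real.sin (Real.arccos (1 - h) / 2) :=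
    Real.sin_nonneg_of_nonneg_of_le_pi (by linarith) (by linarith [Real.pi_pos])
  rw [Real.sqrt_eq_iff_mul_self_eq (by linarith [hh.1]) (by linarith)]
  have h2 := Real.cos_two_mul (Real.arccos (1 - h) / 2)
  rw [mul_div_cancel₀ _ (two_ne_zero' ℝ),
    Real.cos_arccos (by linarith [hh.2]) (by linarith [hh.1])] at h2
  nlinarith [Real.sin_sq_add_cos_sq (Real.arccos (1 - h) / 2)]

theorem eigEqn_iff {L a μ : ℝ} (ha : a ∈ Set.Ioo 0 π) (h : π - a = 2 * L * Real.sin (a / 2)) :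
    EigEqn a μ ↔ μ * (μ + Real.cos (a / 2)) - Real.sin (a / 2) ^ 2 =
      Real.sqrt (1 - μ ^ 2) * (μ + Real.cos (a / 2)) * Real.tan (Real.sqrt (1 - μ ^ 2) * L) := by
  have hs : 0 < Real.sin (a / 2) := Real.sin_pos_of_pos_of_lt_pi (by linarith [ha.1])
    (by linarith [ha.1, ha.2])
  have hc : 0 < Real.cos (a / 2) :=
    Real.cos_pos_of_mem_Ioo ⟨by linarith [ha.1, Real.pi_pos], by linarith [ha.2]⟩
  have h2 := Real.cos_two_mul (a / 2)
  rw [mul_div_cancel₀ _ (two_ne_zero' ℝ)] at h2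
  have h3 := Real.sin_sq_add_cos_sq (a / 2)
  have h4 : Real.sqrt (2 * (1 + Real.cos a)) = 2 * Real.cos (a / 2) := by
    rw [Real.sqrt_eq_iff_mul_self_eq (by nlinarith) (by linarith)]
    linarith
  have h5 : Real.sqrt (2 * (1 - Real.cos a)) = 2 * Real.sin (a / 2) := by
    rw [Real.sqrt_eq_iff_mul_self_eq (by nlinarith) (by linarith)]
    linarith
  rw [EigEqn, h4, h5, h, show Real.sqrt (1 - μ ^ 2) * (2 * L * Real.sin (a / 2)) /
    (2 * Real.sin (a / 2)) = Real.sqrt (1 - μ ^ 2) * L by field_simp,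
    show 1 / 2 * (1 - Real.cos a) = Real.sin (a / 2) ^ 2 by linarith]
  constructor <;> intro h <;> linarith

theorem exists_matching_root {L C S : ℝ} (hL : 0 < L) (hC : 0 < C) (hS : 0 < S)
    (hCS : C ^ 2 + S ^ 2 = 1) :
    ∃ μ ∈ Set.Ioo (0 : ℝ) 1, Real.sqrt (1 - μ ^ 2) * L < π / 2 ∧
      (μ * (μ + C) - S ^ 2) * Real.cos (Real.sqrt (1 - μ ^ 2) * L) =
        Real.sqrt (1 - μ ^ 2) * (μ + C) * Real.sin (Real.sqrt (1 - μ ^ 2) * L) := by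
  set g : ℝ → ℝ := fun μ => (μ * (μ + C) - S ^ 2) * Real.cos (Real.sqrt (1 - μ ^ 2) * L) -
    Real.sqrt (1 - μ ^ 2) * (μ + C) * Real.sin (Real.sqrt (1 - μ ^ 2) * L) with hg
  have hgc : Continuous g := by fun_prop
  have hg1 : 0 < g 1 := by
    simp [hg]
    nlinarith
  suffices h : ∃ μ₀, 0 ≤ μ₀ ∧ μ₀ < 1 ∧ g μ₀ < 0 ∧
      ∀ μ, μ₀ < μ → Real.sqrt (1 - μ ^ 2) * L < π / 2 by
    obtain ⟨μ₀, h0, h1, h2, h3⟩ := h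
    obtain ⟨μ, hμ, he⟩ := intermediate_value_Ioo h1.le hgc.continuousOn ⟨h2, hg1⟩
    exact ⟨μ, ⟨h0.trans_lt hμ.1, hμ.2⟩, h3 μ hμ.1, sub_eq_zero.1 he⟩
  rcases lt_or_ge L (π / 2) with h | h
  · refine ⟨0, le_rfl, one_pos, ?_, fun μ _ => ?_⟩
    · have h1 : 0 < Real.cos L := Real.cos_pos_of_mem_Ioo ⟨by linarith, h⟩
      have h2 : 0 < Real.sin L := Real.sin_pos_of_pos_of_lt_pi hL (by linarith)
      simp [hg]
      nlinarith [mul_pos (pow_pos hS 2) h1, mul_pos hC h2]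
    · have : Real.sqrt (1 - μ ^ 2) ≤ 1 := by
        rw [Real.sqrt_le_one]
        nlinarith [sq_nonneg μ]
      nlinarith
  · have hπ := Real.pi_pos
    have hr0 : 0 < π / 2 / L := by positivity
    have hr1 : π / 2 / L ≤ 1 := (div_le_one hL).2 h
    have hsq : 0 ≤ 1 - (π / 2 / L) ^ 2 := by nlinarith
    have hω : Real.sqrt (1 - Real.sqrt (1 - (π / 2 / L) ^ 2) ^ 2) = π / 2 / L := by
      rw [Real.sq_sqrt hsq, sub_sub_cancel, Real.sqrt_sq hr0.le]
    refine ⟨Real.sqrt (1 - (π / 2 / L) ^ 2), Real.sqrt_nonneg _, ?_, ?_, fun μ hμ => ?_⟩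
    · rw [Real.sqrt_lt' one_pos]
      nlinarith [pow_pos hr0 2]
    · simp only [hg, hω, div_mul_cancel₀ _ hL.ne', Real.cos_pi_div_two, Real.sin_pi_div_two]
      have := mul_pos hr0 (add_pos_of_nonneg_of_pos (Real.sqrt_nonneg (1 - (π / 2 / L) ^ 2)) hC)
      linarith
    · rw [← lt_div_iff₀ hL, Real.sqrt_lt' hr0]
      have := (Real.sqrt_lt' ((Real.sqrt_nonneg _).trans_lt hμ)).1 hμ
      linarith

theorem matching_root_ge {L C S μ μ' : ℝ} (hL : 0 < L) (hC : 0 < C)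
    (hμ : μ ∈ Set.Ioo (0 : ℝ) 1) (hω : Real.sqrt (1 - μ ^ 2) * L < π / 2)
    (he : μ * (μ + C) - S ^ 2 =
      Real.sqrt (1 - μ ^ 2) * (μ + C) * Real.tan (Real.sqrt (1 - μ ^ 2) * L))
    (he' : μ' * (μ' + C) - S ^ 2 =
      Real.sqrt (1 - μ' ^ 2) * (μ' + C) * Real.tan (Real.sqrt (1 - μ' ^ 2) * L)) : μ' ≤ μ := by
  by_contra! hlt
  have hμ0 := hμ.1
  have h1 : 0 < μ + C := by linarith
  have h2 : 0 < μ' + C := by linarith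
  have hωle : Real.sqrt (1 - μ' ^ 2) ≤ Real.sqrt (1 - μ ^ 2) :=
    Real.sqrt_le_sqrt (by nlinarith)
  have hω0 := Real.sqrt_nonneg (1 - μ' ^ 2)
  set w := Real.sqrt (1 - μ ^ 2)
  set w' := Real.sqrt (1 - μ' ^ 2)
  have hwL : w' * L ≤ w * L := by gcongr
  have h0 : 0 ≤ w' * L := by positivity
  have hπ := Real.pi_pos
  have ht : Real.tan (w' * L) ≤ Real.tan (w * L) :=
    Real.strictMonoOn_tan.monotoneOn ⟨by linarith, by linarith⟩ ⟨by linarith, hω⟩ hwL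
  have ht0 : 0 ≤ Real.tan (w' * L) :=
    Real.tan_nonneg_of_nonneg_of_le_pi_div_two h0 (by linarith)
  have h3 : w' * Real.tan (w' * L) ≤ w * Real.tan (w * L) :=
    mul_le_mul hωle ht ht0 (hω0.trans hωle)
  have h4 : w' * Real.tan (w' * L) = μ' - S ^ 2 / (μ' + C) := by
    field_simp
    linarith
  have h5 : w * Real.tan (w * L) = μ - S ^ 2 / (μ + C) := by
    field_simp
    linarith
  have h6 : S ^ 2 / (μ' + C) ≤ S ^ 2 / (μ + C) := by gcongr
  linarith

/-- For `γ = 0`, `d = 0` and half-length `L > 0`, the linearisation about the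
(unique) pinned fluxon has a largest eigenvalue `Λ_max ∈ (−1, 0)`, and
`μ = √(1 + Λ_max) ∈ (0,1)` is the largest solution of the implicit equation,
where `φ_in = arccos(1−h)` and `h ∈ (0,2)` is determined by `L`. -/
theorem stmt6 (L : ℝ) (hL : 0 < L) (φ : ℝ → ℝ) (hφ : IsPinnedFluxon L 0 0 φ)
    (h : ℝ) (hh : h ∈ Set.Ioo (0 : ℝ) 2)
    (hhL : L = (π - Real.arccos (1 - h)) / Real.sqrt (2 * h)) :
    ∃ Λmax : ℝ,
      IsEigenvalue L 0 0 φ Λmax ∧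
      (∀ Λ : ℝ, IsEigenvalue L 0 0 φ Λ → Λ ≤ Λmax) ∧
      -1 < Λmax ∧ Λmax < 0 ∧
      Real.sqrt (1 + Λmax) ∈ Set.Ioo (0 : ℝ) 1 ∧
      EigEqn (Real.arccos (1 - h)) (Real.sqrt (1 + Λmax)) ∧
      (∀ μ' ∈ Set.Ioo (0 : ℝ) 1, EigEqn (Real.arccos (1 - h)) μ' →
        μ' ≤ Real.sqrt (1 + Λmax)) := by
  obtain ⟨-, hαI, hαe⟩ := hφ.edge_values hL
  have ha0 : 0 < Real.arccos (1 - h) := Real.arccos_pos.2 (by linarith [hh.1])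
  have hs0 : 0 < Real.sin (Real.arccos (1 - h) / 2) :=
    Real.sin_pos_of_pos_of_lt_pi (by linarith)
      (by linarith [Real.arccos_le_pi (1 - h), Real.pi_pos])
  rw [sin_half_arccos hh, eq_div_iff (by positivity)] at hhL
  have haI : Real.arccos (1 - h) ∈ Set.Ioo 0 π := by
    refine ⟨ha0, ?_⟩
    have := mul_pos hL hs0
    linarith
  have hae : π - Real.arccos (1 - h) = 2 * L * Real.sin (Real.arccos (1 - h) / 2) := by linarith
  have hα : φ (-L) = Real.arccos (1 - h) := edge_unique hL hαI haI hαe hae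
  have hc0 : 0 < Real.cos (Real.arccos (1 - h) / 2) :=
    Real.cos_pos_of_mem_Ioo ⟨by linarith [Real.pi_pos], by linarith [haI.2]⟩
  obtain ⟨μ, hμ, hωL, hroot⟩ := exists_matching_root hL hc0 hs0 (Real.cos_sq_add_sin_sq _)
  have hμ0 := hμ.1
  have hμ1 := hμ.2
  have hpos : 0 < 1 - μ ^ 2 := by nlinarith
  have hω0 : 0 < Real.sqrt (1 - μ ^ 2) := Real.sqrt_pos.2 hpos
  have hcos : 0 < Real.cos (Real.sqrt (1 - μ ^ 2) * L) :=
    Real.cos_pos_of_mem_Ioo ⟨by linarith [mul_pos hω0 hL, Real.pi_pos], hωL⟩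
  have hsum : 0 < μ + Real.cos (Real.arccos (1 - h) / 2) := by linarith
  have hm : IsMatched L φ μ (Real.sqrt (1 - μ ^ 2))
      (Real.cos (Real.sqrt (1 - μ ^ 2) * L) / (μ + Real.cos (Real.arccos (1 - h) / 2))) :=
    { fluxon := hφ
      L_pos := hL
      mu_pos := hμ0
      omega_pos := hω0
      A_pos := by positivity
      sq_add_sq := by rw [Real.sq_sqrt hpos.le]; ring
      omega_mul_lt := hωL
      value := by rw [hα, div_mul_cancel₀ _ hsum.ne']
      slope := by
        rw [hα, div_mul_eq_mul_div, div_eq_iff hsum.ne']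
        linarith }
  have hroot' : μ * (μ + Real.cos (Real.arccos (1 - h) / 2)) -
      Real.sin (Real.arccos (1 - h) / 2) ^ 2 =
      Real.sqrt (1 - μ ^ 2) * (μ + Real.cos (Real.arccos (1 - h) / 2)) *
        Real.tan (Real.sqrt (1 - μ ^ 2) * L) := by
    rw [Real.tan_eq_sin_div_cos, mul_div_assoc', eq_div_iff hcos.ne', hroot]
  have hsqrt : Real.sqrt (1 + (μ ^ 2 - 1)) = μ := by
    rw [add_sub_cancel, Real.sqrt_sq hμ0.le]
  refine ⟨μ ^ 2 - 1, hm.isEigenvalue, fun Λ hΛ => hm.eigenvalue_le hΛ, by nlinarith, by linarith,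
    ?_⟩
  rw [hsqrt]
  exact ⟨hμ, (eigEqn_iff haI hae).2 hroot', fun μ' _ he => matching_root_ge hL hc0 hμ hωL hroot'
    ((eigEqn_iff haI hae).1 he)⟩
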